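/- arXiv:1405.3232 — 2 statements merged into one kernel-verified Lean document; each statement's English description precedes it below -/
import Mathlib

section
/- Let Λ be the Leech lattice and let φ ∈ O(Λ) be an isometry of order 7. Then either the coinvariant lattice S_φ(Λ) equals Λ (i.e. φ has no nonzero fixed vectors) or S_φ(Λ) has rank 18. -/
open Module

/-- The orthogonal complement of a submodule with respect to a bilinear form. -/
def orthSub {M : Type*} [AddCommGroup M] (b : M →ₗ[ℤ] M →ₗ[ℤ] ℤ)
    (T : Submodule ℤ M) : Submodule ℤ M where
  carrier := {x | ∀ y ∈ T, b x y = 0}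
  add_mem' := by
    intro a c ha hc y hy
    simp only [Set.mem_setOf_eq] at *
    rw [map_add, LinearMap.add_apply, ha y hy, hc y hy, add_zero]
  zero_mem' := by intro y hy; simp
  smul_mem' := by
    intro k x hx y hy
    simp only [Set.mem_setOf_eq] at hx
    rw [map_smul, LinearMap.smul_apply, hx y hy, smul_zero]

/-- The invariant lattice `T_φ` of an isometry. -/
def fixSub {M : Type*} [AddCommGroup M] (φ : M ≃ₗ[ℤ] M) : Submodule ℤ M :=
  LinearMap.ker (φ.toLinearMap - LinearMap.id)

lemma bl_finset {E : Type*} [NormedAddCommGroup E] [InnerProductSpace ℝ E] (L : Submodule ℤ E)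
    (hmin : ∀ v ∈ L, v ≠ 0 → 4 ≤ ‖v‖ ^ 2) (x : E) (t : Finset L) :
    ∑ g ∈ t, (1 - ‖(g : E) + x‖ ^ 2 / 2) ≤ 1 := by
  classical
  rcases t.eq_empty_or_nonempty with rfl | hne
  · simp
  have hm : (1 : ℝ) ≤ t.card := by exact_mod_cast hne.card_pos
  set u : L → E := fun g => (g : E) + x with hu
  have h1 : ∑ i ∈ t, ∑ j ∈ t, ‖u i - u j‖ ^ 2
      = 2 * t.card * ∑ i ∈ t, ‖u i‖ ^ 2 - 2 * ‖∑ i ∈ t, u i‖ ^ 2 := by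
    have : ‖∑ i ∈ t, u i‖ ^ 2 = ∑ i ∈ t, ∑ j ∈ t, inner ℝ (u i) (u j) := by
      rw [← real_inner_self_eq_norm_sq, sum_inner]
      simp_rw [inner_sum]
    rw [this]
    simp_rw [norm_sub_sq_real, Finset.sum_add_distrib, Finset.sum_sub_distrib, Finset.sum_const,
      nsmul_eq_mul, ← Finset.mul_sum]
    ring
  have h2 : ∑ i ∈ t, ∑ j ∈ t, ‖u i - u j‖ ^ 2 ≥ 4 * t.card * (t.card - 1) := by
    have : ∀ i ∈ t, 4 * ((t.card : ℝ) - 1) ≤ ∑ j ∈ t, ‖u i - u j‖ ^ 2 := by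
      intro i hi
      rw [← Finset.add_sum_erase t _ hi]
      have : ∑ j ∈ t.erase i, (4 : ℝ) ≤ ∑ j ∈ t.erase i, ‖u i - u j‖ ^ 2 := by
        apply Finset.sum_le_sum
        intro j hj
        have hj' := Finset.ne_of_mem_erase hj
        have := hmin ((i - j : L) : E) (i - j).2 (by
          rw [Ne, Submodule.coe_eq_zero, sub_eq_zero]; exact fun h => hj' h.symm)
        simpa [hu] using this
      rw [Finset.sum_const, Finset.card_erase_of_mem hi, nsmul_eq_mul,
        Nat.cast_sub hne.card_pos] at this
      simp only [sub_self, norm_zero]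
      push_cast at this
      linarith
    calc _ ≥ ∑ i ∈ t, 4 * ((t.card : ℝ) - 1) := Finset.sum_le_sum this
      _ = _ := by rw [Finset.sum_const, nsmul_eq_mul]; ring
  have h3 : 2 * ((t.card : ℝ) - 1) ≤ ∑ i ∈ t, ‖u i‖ ^ 2 := by
    have h4 : (t.card : ℝ) * (2 * ((t.card : ℝ) - 1)) ≤ t.card * ∑ i ∈ t, ‖u i‖ ^ 2 := by
      nlinarith [sq_nonneg ‖∑ i ∈ t, u i‖]
    exact le_of_mul_le_mul_left h4 (by linarith)
  rw [Finset.sum_sub_distrib, ← Finset.sum_div, Finset.sum_const, nsmul_eq_mul]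
  linarith

lemma bl_tsum {E : Type*} [NormedAddCommGroup E] [InnerProductSpace ℝ E] (L : Submodule ℤ E)
    (hmin : ∀ v ∈ L, v ≠ 0 → 4 ≤ ‖v‖ ^ 2) (x : E) :
    ∑' g : L, ENNReal.ofReal (1 - ‖g +ᵥ x‖ ^ 2 / 2) ≤ 1 := by
  classical
  rw [ENNReal.tsum_eq_iSup_sum]
  refine iSup_le fun t => ?_
  rw [← Finset.sum_filter_add_sum_filter_not t (fun g : L => 0 ≤ 1 - ‖g +ᵥ x‖ ^ 2 / 2)]
  rw [Finset.sum_eq_zero (s := t.filter (fun g : L => ¬ 0 ≤ 1 - ‖g +ᵥ x‖ ^ 2 / 2)), add_zero]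
  · rw [← ENNReal.ofReal_sum_of_nonneg]
    · rw [ENNReal.ofReal_le_one]
      exact bl_finset L hmin x _
    · intro i hi
      exact (Finset.mem_filter.1 hi).2
  · intro i hi
    exact ENNReal.ofReal_of_nonpos (not_le.1 (Finset.mem_filter.1 hi).2).le

open MeasureTheory in
lemma bl_int {E : Type*} [NormedAddCommGroup E] [InnerProductSpace ℝ E] [FiniteDimensional ℝ E]
    [MeasurableSpace E] [BorelSpace E] {ι : Type*} [Fintype ι] (b : Basis ι ℝ E)
    (hmin : ∀ v ∈ Submodule.span ℤ (Set.range b), v ≠ 0 → 4 ≤ ‖v‖ ^ 2) :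
    ∫⁻ x : E, ENNReal.ofReal (1 - ‖x‖ ^ 2 / 2) ≤ volume (ZSpan.fundamentalDomain b) := by
  have : Countable (Submodule.span ℤ (Set.range b)).toAddSubgroup :=
    inferInstanceAs (Countable (Submodule.span ℤ (Set.range b)))
  have hF := ZSpan.isAddFundamentalDomain' b (volume : Measure E)
  rw [hF.lintegral_eq_tsum'', ← lintegral_tsum]
  · calc _ ≤ ∫⁻ x in ZSpan.fundamentalDomain b, 1 := by
          apply lintegral_mono
          intro x
          exact bl_tsum _ hmin x
      _ = _ := by simp
  · intro g
    apply Measurable.aemeasurable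
    have : Measurable (fun x : E => (g : E) + x) := by fun_prop
    change Measurable (fun x : E => ENNReal.ofReal (1 - ‖(g : E) + x‖ ^ 2 / 2))
    fun_prop

open MeasureTheory in
lemma bl_lower {E : Type*} [NormedAddCommGroup E] [InnerProductSpace ℝ E] [FiniteDimensional ℝ E]
    [MeasurableSpace E] [BorelSpace E] [Nontrivial E] {k : ℕ} (hk : finrank ℝ E = 2 * k) :
    ENNReal.ofReal ((0.07 * 1.86 ^ k + 0.09 * 1.68 ^ k + 0.14 * 1.4 ^ k)
      * (Real.pi ^ k / k.factorial)) ≤ ∫⁻ x : E, ENNReal.ofReal (1 - ‖x‖ ^ 2 / 2) := by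
  have hv : ∀ c w : ℝ, 0 ≤ c → 0 ≤ w →
      ∫⁻ x : E, (Metric.ball (0 : E) (√c)).indicator (fun _ => ENNReal.ofReal w) x
        = ENNReal.ofReal (w * c ^ k * (Real.pi ^ k / k.factorial)) := by
    intro c w hc hw
    rw [lintegral_indicator Metric.isOpen_ball.measurableSet, setLIntegral_const,
      InnerProductSpace.volume_ball_of_dim_even hk, hk,
      ← ENNReal.ofReal_pow (Real.sqrt_nonneg _), pow_mul, Real.sq_sqrt hc,
      ← ENNReal.ofReal_mul (by positivity), ← ENNReal.ofReal_mul hw]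
    ring_nf
  have hm : ∀ c w : ℝ, Measurable ((Metric.ball (0 : E) (√c)).indicator
      (fun _ => ENNReal.ofReal w)) := fun c w =>
    measurable_const.indicator Metric.isOpen_ball.measurableSet
  calc _ = ∫⁻ x : E, ((Metric.ball (0 : E) (√1.86)).indicator (fun _ => ENNReal.ofReal 0.07) x
        + (Metric.ball (0 : E) (√1.68)).indicator (fun _ => ENNReal.ofReal 0.09) x
        + (Metric.ball (0 : E) (√1.4)).indicator (fun _ => ENNReal.ofReal 0.14) x) := by
        rw [lintegral_add_right _ (hm _ _), lintegral_add_right _ (hm _ _),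
          hv _ _ (by norm_num) (by norm_num), hv _ _ (by norm_num) (by norm_num),
          hv _ _ (by norm_num) (by norm_num),
          ← ENNReal.ofReal_add (by positivity) (by positivity),
          ← ENNReal.ofReal_add (by positivity) (by positivity)]
        ring_nf
    _ ≤ _ := by
        apply lintegral_mono
        intro x
        classical
        simp only [Set.indicator_apply, mem_ball_zero_iff]
        have hs : ∀ c : ℝ, ‖x‖ < √c ↔ ‖x‖ ^ 2 < c := fun c => Real.lt_sqrt (norm_nonneg x)
        simp only [hs]
        split_ifs <;> try simp only [add_zero, zero_add, zero_le]
        all_goals first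
        | (exfalso; linarith)
        | (rw [← ENNReal.ofReal_add (by norm_num) (by norm_num),
            ← ENNReal.ofReal_add (by norm_num) (by norm_num)]
           apply ENNReal.ofReal_le_ofReal; linarith)
        | (rw [← ENNReal.ofReal_add (by norm_num) (by norm_num)]
           apply ENNReal.ofReal_le_ofReal; linarith)
        | (apply ENNReal.ofReal_le_ofReal; linarith)

open MeasureTheory in
lemma bl_mat {n k : ℕ} (hk : n = 2 * k) (hk0 : 0 < k) (B : Matrix (Fin n) (Fin n) ℝ)
    (hdet : B.det ≠ 0)
    (hmin : ∀ z : Fin n → ℤ, z ≠ 0 → 4 ≤ (B.mulVec (fun i => (z i : ℝ))) ⬝ᵥ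
      (B.mulVec (fun i => (z i : ℝ)))) :
    (0.07 * 1.86 ^ k + 0.09 * 1.68 ^ k + 0.14 * 1.4 ^ k)
      * (Real.pi ^ k / k.factorial) ≤ |B.det| := by
  classical
  have hn : Nonempty (Fin n) := ⟨⟨0, by omega⟩⟩
  let b₀ := EuclideanSpace.basisFun (Fin n) ℝ
  have hU : IsUnit (Matrix.toLin b₀.toBasis b₀.toBasis B).det := by
    rw [LinearMap.det_toLin]; exact hdet.isUnit
  let e := LinearMap.equivOfDetNeZero (Matrix.toLin b₀.toBasis b₀.toBasis B) hU.ne_zero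
  let b : Basis (Fin n) ℝ (EuclideanSpace ℝ (Fin n)) := b₀.toBasis.map e
  have hbi : ∀ i, b i = Matrix.toLin b₀.toBasis b₀.toBasis B (b₀.toBasis i) := fun i => rfl
  have hbij : ∀ i j, (b i).ofLp j = B j i := by
    intro i j
    rw [hbi, Matrix.toLin_self, WithLp.ofLp_sum, Finset.sum_apply]
    simp [b₀]
  have hbdet : b₀.toBasis.det b = B.det := by
    rw [Basis.det_apply]
    congr 1
    ext i j
    rw [Basis.toMatrix_apply, hbi, Matrix.toLin_self]
    simp
  have h0 : volume (ZSpan.fundamentalDomain b₀.toBasis) = 1 := by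
    rw [measure_congr (ZSpan.fundamentalDomain_ae_parallelepiped b₀.toBasis volume)]
    simpa using b₀.volume_parallelepiped
  have hvol : volume (ZSpan.fundamentalDomain b) = ENNReal.ofReal |B.det| := by
    rw [ZSpan.measure_fundamentalDomain b volume b₀.toBasis, hbdet, h0, mul_one]
  have hmin' : ∀ v ∈ Submodule.span ℤ (Set.range b), v ≠ 0 → 4 ≤ ‖v‖ ^ 2 := by
    intro v hv hv0
    obtain ⟨z, rfl⟩ := (Submodule.mem_span_range_iff_exists_fun ℤ).1 hv
    have hz : z ≠ 0 := by rintro rfl; simp at hv0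
    have := hmin z hz
    have hvv : ∑ i, z i • b i = WithLp.toLp 2 (B.mulVec (fun i => (z i : ℝ))) := by
      ext j
      rw [WithLp.ofLp_sum, Finset.sum_apply]
      simp [hbij, Matrix.mulVec, dotProduct, mul_comm]
    rw [hvv, EuclideanSpace.norm_sq_eq]
    simpa [dotProduct, pow_two] using this
  have hfr : finrank ℝ (EuclideanSpace ℝ (Fin n)) = 2 * k := by simp [hk]
  have : Nontrivial (EuclideanSpace ℝ (Fin n)) := Module.nontrivial_of_finrank_pos (R := ℝ) (by omega)
  have := (bl_lower (E := EuclideanSpace ℝ (Fin n)) hfr).trans (bl_int b hmin')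
  rw [hvol] at this
  exact (ENNReal.ofReal_le_ofReal_iff (abs_nonneg _)).1 this

lemma psd_of_int {n : ℕ} (G : Matrix (Fin n) (Fin n) ℤ) (hs : G.transpose = G)
    (hmin : ∀ z : Fin n → ℤ, z ≠ 0 → 4 ≤ z ⬝ᵥ G.mulVec z) :
    (G.map (Int.cast : ℤ → ℝ)).PosSemidef := by
  set A := G.map (Int.cast : ℤ → ℝ) with hA
  have hint : ∀ z : Fin n → ℤ, (0 : ℝ) ≤ (fun i => (z i : ℝ)) ⬝ᵥ A.mulVec (fun i => (z i : ℝ)) := by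
    intro z
    have h : (0 : ℤ) ≤ z ⬝ᵥ G.mulVec z := by
      by_cases hz : z = 0
      · simp [hz]
      · linarith [hmin z hz]
    have : ((z ⬝ᵥ G.mulVec z : ℤ) : ℝ) =
        (fun i => (z i : ℝ)) ⬝ᵥ A.mulVec (fun i => (z i : ℝ)) := by
      simp [dotProduct, Matrix.mulVec, hA]
    rw [← this]
    exact_mod_cast h
  have hrat : ∀ q : Fin n → ℚ, (0 : ℝ) ≤ (fun i => (q i : ℝ)) ⬝ᵥ A.mulVec (fun i => (q i : ℝ)) := by
    intro q
    obtain ⟨d, hd⟩ := IsLocalization.exist_integer_multiples_of_finite (nonZeroDivisors ℤ) q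
    choose z hz using hd
    have hd0 : ((d : ℤ) : ℝ) ≠ 0 := by exact_mod_cast nonZeroDivisors.ne_zero d.2
    have hz' : (fun i => (z i : ℝ)) = ((d : ℤ) : ℝ) • (fun i => (q i : ℝ)) := by
      ext i
      have := hz i
      simp only [algebraMap_int_eq, eq_intCast, zsmul_eq_mul] at this
      simp only [Pi.smul_apply, smul_eq_mul]
      exact_mod_cast this
    have := hint z
    rw [hz', Matrix.mulVec_smul, smul_dotProduct, dotProduct_smul, smul_eq_mul, smul_eq_mul,
      ← mul_assoc] at this
    exact nonneg_of_mul_nonneg_right this (mul_self_pos.2 hd0)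
  have hden : DenseRange (fun q : Fin n → ℚ => fun i => (q i : ℝ)) :=
    DenseRange.piMap (fun _ => Rat.denseRange_cast)
  have hcl : IsClosed {x : Fin n → ℝ | 0 ≤ x ⬝ᵥ A.mulVec x} := by
    apply isClosed_le continuous_const
    fun_prop
  have hall : ∀ x : Fin n → ℝ, 0 ≤ x ⬝ᵥ A.mulVec x := fun x =>
    hden.induction_on (p := fun x => 0 ≤ x ⬝ᵥ A.mulVec x) x hcl hrat
  refine Matrix.PosSemidef.of_dotProduct_mulVec_nonneg ?_ ?_
  · ext i j
    have := congrFun (congrFun hs i) j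
    simp only [Matrix.transpose_apply] at this
    simp [hA, this]
  · intro x
    simpa using hall x

open scoped MatrixOrder in
lemma det_bound {n k : ℕ} (hk : n = 2 * k) (hk0 : 0 < k) (G : Matrix (Fin n) (Fin n) ℤ)
    (hs : G.transpose = G) (hdet : G.det ≠ 0)
    (hmin : ∀ z : Fin n → ℤ, z ≠ 0 → 4 ≤ z ⬝ᵥ G.mulVec z) :
    ((0.07 * 1.86 ^ k + 0.09 * 1.68 ^ k + 0.14 * 1.4 ^ k)
      * (Real.pi ^ k / k.factorial)) ^ 2 ≤ (G.det : ℝ) := by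
  have hP := psd_of_int G hs hmin
  obtain ⟨B, hB⟩ := CStarAlgebra.nonneg_iff_eq_star_mul_self.1 (Matrix.nonneg_iff_posSemidef.2 hP)
  have hB' : G.map (Int.cast : ℤ → ℝ) = B.transpose * B := by
    rw [hB, Matrix.star_eq_conjTranspose, Matrix.conjTranspose_eq_transpose_of_trivial]
  have hd : (G.det : ℝ) = B.det ^ 2 := by
    have := congrArg Matrix.det hB'
    rw [Matrix.det_mul, Matrix.det_transpose, ← pow_two] at this
    rw [← this]
    exact Int.cast_det G
  have hBd : B.det ≠ 0 := by
    intro h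
    rw [h] at hd
    apply hdet
    have : (G.det : ℝ) = 0 := by rw [hd]; simp
    exact_mod_cast this
  have := bl_mat hk hk0 B hBd (by
    intro z hz
    have h4 := hmin z hz
    have : ((z ⬝ᵥ G.mulVec z : ℤ) : ℝ) =
        (fun i => (z i : ℝ)) ⬝ᵥ (G.map (Int.cast : ℤ → ℝ)).mulVec (fun i => (z i : ℝ)) := by
      simp [dotProduct, Matrix.mulVec]
    rw [hB', ← Matrix.mulVec_mulVec, Matrix.dotProduct_mulVec (fun i => (z i : ℝ)),
      Matrix.vecMul_transpose] at this
    rw [← this]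
    exact_mod_cast h4)
  rw [hd, ← sq_abs B.det]
  exact pow_le_pow_left₀ (by positivity) this 2

lemma det_bound6 (G : Matrix (Fin 6) (Fin 6) ℤ)
    (hs : G.transpose = G) (hdet : G.det ≠ 0)
    (hmin : ∀ z : Fin 6 → ℤ, z ≠ 0 → 4 ≤ z ⬝ᵥ G.mulVec z) : 7 < G.det := by
  have h := det_bound (k := 3) rfl (by norm_num) G hs hdet hmin
  have hp : (3.14 : ℝ) ^ 3 ≤ Real.pi ^ 3 := pow_le_pow_left₀ (by norm_num) Real.pi_gt_d2.le 3
  have : (7 : ℝ) < G.det := by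
    refine lt_of_lt_of_le ?_ h
    refine lt_of_lt_of_le ?_ (pow_le_pow_left₀ (by positivity)
      (mul_le_mul_of_nonneg_left (div_le_div_of_nonneg_right hp (by positivity)) (by positivity)) 2)
    norm_num [Nat.factorial]
  exact_mod_cast this

lemma det_bound12 (G : Matrix (Fin 12) (Fin 12) ℤ)
    (hs : G.transpose = G) (hdet : G.det ≠ 0)
    (hmin : ∀ z : Fin 12 → ℤ, z ≠ 0 → 4 ≤ z ⬝ᵥ G.mulVec z) : 49 < G.det := by
  have h := det_bound (k := 6) rfl (by norm_num) G hs hdet hmin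
  have hp : (3.14 : ℝ) ^ 6 ≤ Real.pi ^ 6 := pow_le_pow_left₀ (by norm_num) Real.pi_gt_d2.le 6
  have : (49 : ℝ) < G.det := by
    refine lt_of_lt_of_le ?_ h
    refine lt_of_lt_of_le ?_ (pow_le_pow_left₀ (by positivity)
      (mul_le_mul_of_nonneg_left (div_le_div_of_nonneg_right hp (by positivity)) (by positivity)) 2)
    norm_num [Nat.factorial]
  exact_mod_cast this

lemma prod_seven {R : Type*} [Ring R] (F : R)
    (h : 1 + F + F ^ 2 + F ^ 3 + F ^ 4 + F ^ 5 + F ^ 6 = 0) :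
    (F - 1) * (F ^ 2 - 1) * (F ^ 3 - 1) * (F ^ 4 - 1) * (F ^ 5 - 1) * (F ^ 6 - 1) = 7 := by
  have h1 : ∀ X : Polynomial ℤ,
      (X - 1) * (X ^ 2 - 1) * (X ^ 3 - 1) * (X ^ 4 - 1) * (X ^ 5 - 1) * (X ^ 6 - 1) =
      7 + (1 + X + X ^ 2 + X ^ 3 + X ^ 4 + X ^ 5 + X ^ 6) *
      ((-6)*X^0 + (5)*X^1 + (1)*X^3 + (1)*X^5 + (-1)*X^6 + (-4)*X^7 + (3)*X^8 + (-1)*X^9 + (1)*X^10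
        + (1)*X^12 + (-2)*X^14 + (1)*X^15) := by
    intro X; ring
  have h2 := congrArg (Polynomial.aeval F) (h1 Polynomial.X)
  rw [map_add, map_mul (Polynomial.aeval F) (1 + _ + _ + _ + _ + _ + _)] at h2
  have h3 : (Polynomial.aeval F) (1 + Polynomial.X + Polynomial.X ^ 2 + Polynomial.X ^ 3 +
      Polynomial.X ^ 4 + Polynomial.X ^ 5 + Polynomial.X ^ 6 : Polynomial ℤ) = 0 := by
    simpa using h
  rw [h3, zero_mul, add_zero] at h2
  have h4 : (Polynomial.aeval F) (7 : Polynomial ℤ) = 7 := map_ofNat _ 7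
  rw [h4] at h2
  simpa using h2

lemma det_seven {n : ℕ} (F : Matrix (Fin n) (Fin n) ℤ)
    (h : 1 + F + F ^ 2 + F ^ 3 + F ^ 4 + F ^ 5 + F ^ 6 = 0) :
    (F - 1).det.natAbs ^ 6 = 7 ^ n := by
  have h7 : F ^ 7 = 1 := by
    have := mul_geom_sum F 7
    simp only [Finset.sum_range_succ, Finset.sum_range_zero, zero_add, pow_zero, pow_one] at this
    rw [h, mul_zero] at this
    exact (sub_eq_zero.1 this.symm)
  have key : ∀ a b c : ℕ, a * b = 7 * c + 1 → (F ^ a - 1).det.natAbs = (F - 1).det.natAbs := by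
    intro a b c habc
    apply Nat.dvd_antisymm
    · rw [Int.natAbs_dvd_natAbs]
      have := mul_geom_sum (F ^ a) b
      rw [← pow_mul, habc, pow_add, pow_mul, h7, one_pow, one_mul, pow_one] at this
      rw [← this, Matrix.det_mul]
      exact dvd_mul_right _ _
    · rw [Int.natAbs_dvd_natAbs, ← mul_geom_sum F a, Matrix.det_mul]
      exact dvd_mul_right _ _
  have hp := congrArg (fun M => (Matrix.det M).natAbs) (prod_seven F h)
  simp only [Matrix.det_mul, Int.natAbs_mul] at hp
  rw [key 2 4 1 rfl, key 3 5 2 rfl, key 4 2 1 rfl, key 5 3 2 rfl, key 6 6 5 rfl] at hp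
  have h77 : (7 : Matrix (Fin n) (Fin n) ℤ).det.natAbs = 7 ^ n := by
    have : (7 : Matrix (Fin n) (Fin n) ℤ) = (7 : ℤ) • (1 : Matrix (Fin n) (Fin n) ℤ) := by
      rw [zsmul_one]; norm_num
    rw [this, Matrix.det_smul]
    simp [Int.natAbs_pow]
  rw [h77] at hp
  rw [← hp]; ring

lemma mem_orthSub {M : Type*} [AddCommGroup M] (b : M →ₗ[ℤ] M →ₗ[ℤ] ℤ)
    (T : Submodule ℤ M) (x : M) : x ∈ orthSub b T ↔ ∀ y ∈ T, b x y = 0 := Iff.rfl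

lemma mem_fixSub {M : Type*} [AddCommGroup M] (φ : M ≃ₗ[ℤ] M) (x : M) :
    x ∈ fixSub φ ↔ φ x = x := by
  simp [fixSub, sub_eq_zero]

lemma main_aux
    (Λ : Type*) [AddCommGroup Λ] [Module.Free ℤ Λ] [Module.Finite ℤ Λ]
    (bΛ : Λ →ₗ[ℤ] Λ →ₗ[ℤ] ℤ)
    (hsymm : ∀ x y : Λ, bΛ x y = bΛ y x)
    (heven : ∀ x : Λ, Even (bΛ x x))
    (hneg : ∀ x : Λ, x ≠ 0 → bΛ x x < 0)
    (hrank : finrank ℤ Λ = 24)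
    (hunimodular : Function.Bijective bΛ)
    (hnoroot : ∀ x : Λ, bΛ x x ≠ -2)
    (φ : Λ ≃ₗ[ℤ] Λ)
    (hiso : ∀ x y : Λ, bΛ (φ x) (φ y) = bΛ x y)
    (hord : orderOf φ = 7) (S : Submodule ℤ Λ) (hS : S = orthSub bΛ (fixSub φ)) :
    S = ⊤ ∨ finrank ℤ S = 18 := by
  classical
  have hmemS : ∀ x, x ∈ S ↔ ∀ y, φ y = y → bΛ x y = 0 := by
    intro x
    rw [hS, mem_orthSub]
    simp only [mem_fixSub]
  -- S is a kernel
  let f : Λ →ₗ[ℤ] (fixSub φ →ₗ[ℤ] ℤ) := (LinearMap.lcomp ℤ ℤ (fixSub φ).subtype) ∘ₗ bΛ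
  have hf : LinearMap.ker f = S := by
    ext x
    rw [LinearMap.mem_ker, hS, mem_orthSub]
    constructor
    · intro h y hy
      exact LinearMap.congr_fun h ⟨y, hy⟩
    · intro h
      ext y
      exact h y y.2
  obtain ⟨g, hg⟩ := f.rangeRestrict.exists_rightInverse_of_surjective f.range_rangeRestrict
  have hproj : ∀ x, x - g (f.rangeRestrict x) ∈ S := by
    intro x
    rw [← hf, LinearMap.mem_ker, map_sub, sub_eq_zero]
    have := LinearMap.congr_fun hg (f.rangeRestrict x)
    exact (congrArg Subtype.val this).symm
  let p : Λ →ₗ[ℤ] S := (LinearMap.id - g ∘ₗ f.rangeRestrict).codRestrict S hproj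
  have hp : ∀ x : S, p x = x := by
    intro x
    apply Subtype.ext
    have : f.rangeRestrict x = 0 := by
      apply Subtype.ext
      have h : (x : Λ) ∈ LinearMap.ker f := hf.ge x.2
      exact h
    simp [p, this]
  have hrk : finrank ℤ (LinearMap.range f) + finrank ℤ S = 24 := by
    rw [← hrank, ← Submodule.finrank_quotient_add_finrank (LinearMap.ker f), hf,
      ← LinearEquiv.finrank_eq f.quotKerEquivRange, hf]
  -- φ preserves S
  have hφ7 : ∀ x, φ (φ (φ (φ (φ (φ (φ x)))))) = x := by
    intro x
    have h := pow_orderOf_eq_one φ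
    rw [hord] at h
    have := LinearEquiv.congr_fun h x
    simpa [pow_succ] using this
  have hφS : ∀ x ∈ S, φ x ∈ S := by
    intro x hx
    rw [hmemS] at hx ⊢
    intro y hy
    have := hiso x y
    rw [hy] at this
    rw [this]; exact hx y hy
  have hsubS : ∀ x, x - φ x ∈ S := by
    intro x
    rw [hmemS]
    intro y hy
    have := hiso x y
    rw [hy] at this
    simp [this]
  let F : S →ₗ[ℤ] S := φ.toLinearMap.restrict hφS
  have hFv : ∀ x : S, ((F x : S) : Λ) = φ x := fun x => rfl
  have hFsum : 1 + F + F ^ 2 + F ^ 3 + F ^ 4 + F ^ 5 + F ^ 6 = 0 := by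
    refine LinearMap.ext fun x => Subtype.ext ?_
    set y : S := (1 + F + F ^ 2 + F ^ 3 + F ^ 4 + F ^ 5 + F ^ 6 : Module.End ℤ S) x with hy
    have hyv : (y : Λ) = x + φ x + φ (φ x) + φ (φ (φ x)) + φ (φ (φ (φ x)))
        + φ (φ (φ (φ (φ x)))) + φ (φ (φ (φ (φ (φ x))))) := by
      simp [hy, pow_succ, hFv]
    have hfix : φ y = y := by
      rw [hyv]
      simp only [map_add, hφ7]
      abel
    have h0 := (hmemS y).1 y.2 y hfix
    by_contra hne
    have := hneg y hne
    omega
  -- basis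
  obtain ⟨r, hr⟩ : ∃ r, finrank ℤ S = r := ⟨_, rfl⟩
  let e := Module.finBasisOfFinrankEq ℤ S hr
  let G : Matrix (Fin r) (Fin r) ℤ := Matrix.of fun i j => -bΛ (e i) (e j)
  let M : Matrix (Fin r) (Fin r) ℤ := LinearMap.toMatrixAlgEquiv e F
  have hM : 1 + M + M ^ 2 + M ^ 3 + M ^ 4 + M ^ 5 + M ^ 6 = 0 := by
    have := congrArg (LinearMap.toMatrixAlgEquiv e) hFsum
    simpa only [map_add, map_pow, map_one, map_zero] using this
  have hdet7 := det_seven M hM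
  -- dual vectors
  have hdual : ∀ i, ∃ l : Λ, ∀ x : S, bΛ l x = e.coord i x := by
    intro i
    obtain ⟨l, hl⟩ := hunimodular.2 (e.coord i ∘ₗ p)
    refine ⟨l, fun x => ?_⟩
    rw [hl, LinearMap.comp_apply, hp]
  choose l hl using hdual
  let N : Matrix (Fin r) (Fin r) ℤ := Matrix.of fun i k => e.repr ⟨l i - φ (l i), hsubS _⟩ k
  have hsumN : ∀ i, l i - φ (l i) = ∑ k, N i k • (e k : Λ) := by
    intro i
    have := congrArg Subtype.val (e.sum_repr ⟨l i - φ (l i), hsubS _⟩)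
    rw [Submodule.coe_sum] at this
    exact this.symm
  have hsumM : ∀ j, φ (e j) = ∑ k, M k j • (e k : Λ) := by
    intro j
    have := congrArg Subtype.val (e.sum_repr (F (e j)))
    rw [Submodule.coe_sum] at this
    rw [← hFv, ← this]
    simp [M, LinearMap.toMatrixAlgEquiv_apply]
  have hNGM : N * G * M = 1 - M := by
    ext i j
    have h1 : bΛ (l i - φ (l i)) (φ (e j)) = M i j - (1 : Matrix (Fin r) (Fin r) ℤ) i j := by
      rw [map_sub, LinearMap.sub_apply, hiso, ← hFv, hl, hl]
      simp [M, LinearMap.toMatrixAlgEquiv_apply, Matrix.one_apply, Finsupp.single_apply, eq_comm]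
    rw [hsumN, hsumM] at h1
    simp only [map_sum, LinearMap.sum_apply, map_smul, LinearMap.smul_apply, smul_eq_mul] at h1
    rw [Matrix.sub_apply, ← neg_sub, ← h1, Matrix.mul_apply]
    simp only [Matrix.mul_apply, G, Matrix.of_apply, Finset.sum_mul, Finset.mul_sum,
      ← Finset.sum_neg_distrib]
    refine Finset.sum_congr rfl fun a _ => Finset.sum_congr rfl fun c _ => ?_
    ring
  have hdvd : G.det ∣ (M - 1).det := by
    rw [← neg_sub 1 M, ← hNGM, Matrix.det_neg, Matrix.det_mul, Matrix.det_mul]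
    exact Dvd.intro_left ((-1) ^ Fintype.card (Fin r) * N.det * M.det) (by ring)
  have hGs : G.transpose = G := by
    ext i j
    simp [G, hsymm (e i) (e j)]
  have hGmin : ∀ z : Fin r → ℤ, z ≠ 0 → 4 ≤ z ⬝ᵥ G.mulVec z := by
    intro z hz
    set v : S := ∑ i, z i • e i with hv
    have hv0 : v ≠ 0 := by
      intro h
      apply hz
      ext i
      have := congrArg (fun x => e.repr x i) h
      simpa [hv, Finsupp.single_apply] using this
    have hvΛ : (v : Λ) ≠ 0 := by simpa using hv0
    have h1 := hneg v hvΛ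
    have h2 := hnoroot v
    obtain ⟨c, hc⟩ := heven (v : Λ)
    have h3 : z ⬝ᵥ G.mulVec z = - bΛ v v := by
      have : (v : Λ) = ∑ i, z i • (e i : Λ) := by simp [hv]
      rw [this]
      simp only [map_sum, LinearMap.sum_apply, map_smul, LinearMap.smul_apply, smul_eq_mul,
        dotProduct, Matrix.mulVec, G, Matrix.of_apply, Finset.mul_sum, ← Finset.sum_neg_distrib]
      rw [Finset.sum_comm]
      refine Finset.sum_congr rfl fun a _ => Finset.sum_congr rfl fun c _ => ?_
      ring
    rw [h3]; omega
  -- numerics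
  obtain ⟨m, hm, hdm⟩ := (Nat.dvd_prime_pow (by norm_num : Nat.Prime 7)).1
    (hdet7 ▸ dvd_pow_self _ (by norm_num) : (M - 1).det.natAbs ∣ 7 ^ r)
  have hrm : r = 6 * m := by
    rw [hdm, ← pow_mul] at hdet7
    have := Nat.pow_right_injective (le_refl 2 |>.trans (by norm_num : 2 ≤ 7)) hdet7
    omega
  have hMne : (M - 1).det ≠ 0 := by
    intro h
    rw [h] at hdm
    exact absurd hdm.symm (pow_ne_zero m (by norm_num))
  have hGne : G.det ≠ 0 := fun h => hMne (by rw [h] at hdvd; exact zero_dvd_iff.1 hdvd)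
  have hGle : G.det ≤ 7 ^ m := by
    have h1 := Nat.le_of_dvd (by rw [hdm]; positivity) (Int.natAbs_dvd_natAbs.2 hdvd)
    rw [hdm] at h1
    have h2 : ((G.det.natAbs : ℕ) : ℤ) ≤ 7 ^ m := by exact_mod_cast h1
    exact Int.le_natAbs.trans h2
  have hr0 : r ≠ 0 := by
    intro h
    have hbot : S = ⊥ := Submodule.finrank_eq_zero.1 (hr.trans h)
    have : φ = 1 := by
      ext x
      have := hsubS x
      rw [hbot, Submodule.mem_bot, sub_eq_zero] at this
      exact this.symm
    rw [this, orderOf_one] at hord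
    omega
  have hm4 : m ≤ 4 := by omega
  interval_cases m
  · omega
  · exfalso
    subst hrm
    have := det_bound6 G hGs hGne hGmin
    omega
  · exfalso
    subst hrm
    have := det_bound12 G hGs hGne hGmin
    omega
  · right; omega
  · left
    have h0 : finrank ℤ (LinearMap.range f) = 0 := by omega
    have hb : LinearMap.range f = ⊥ := Submodule.finrank_eq_zero.1 h0
    rw [← hf]
    exact LinearMap.ker_eq_top.2 (LinearMap.range_eq_bot.1 hb)

/-- the coinvariant lattice of an order-7 isometry of the Leech lattice
is either the whole Leech lattice or has rank 18. -/
theorem stmt13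
    (Λ : Type*) [AddCommGroup Λ] [Module.Free ℤ Λ] [Module.Finite ℤ Λ]
    (bΛ : Λ →ₗ[ℤ] Λ →ₗ[ℤ] ℤ)
    (hsymm : ∀ x y : Λ, bΛ x y = bΛ y x)
    (heven : ∀ x : Λ, Even (bΛ x x))
    (hneg : ∀ x : Λ, x ≠ 0 → bΛ x x < 0)
    (hrank : finrank ℤ Λ = 24)
    (hunimodular : Function.Bijective bΛ)
    (hnoroot : ∀ x : Λ, bΛ x x ≠ -2)
    (φ : Λ ≃ₗ[ℤ] Λ)
    (hiso : ∀ x y : Λ, bΛ (φ x) (φ y) = bΛ x y)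
    (hord : orderOf φ = 7) :
    orthSub bΛ (fixSub φ) = ⊤ ∨ finrank ℤ (orthSub bΛ (fixSub φ)) = 18 :=
  main_aux Λ bΛ hsymm heven hneg hrank hunimodular hnoroot φ hiso hord _ rfl
end

section
/- Let Λ be the Leech lattice and let f ∈ O(Λ) be an isometry of prime order p with p ≥ 13. Then the coinvariant lattice S_f(Λ) has rank at least 22. -/
open Module

section Helpers
open MeasureTheory
open scoped Pointwise MatrixOrder

lemma aux_card {n : ℕ} {ι : Type*} [DecidableEq ι] (s : Finset ι) (u : ι → Fin n → ℝ)
    (h1 : ∀ g ∈ s, ∑ i, (u g i)^2 < 3/2)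
    (h2 : ∀ g ∈ s, ∀ h ∈ s, g ≠ h → 4 ≤ ∑ i, (u g i - u h i)^2) : s.card ≤ 3 := by
  rcases s.eq_empty_or_nonempty with rfl | hs
  · simp
  have hk : 0 < s.card := hs.card_pos
  have e1 : ∑ g ∈ s, ∑ h ∈ s, ∑ i, (u g i - u h i)^2 ≤ 2 * s.card * ∑ g ∈ s, ∑ i, (u g i)^2 := by
    have : ∀ i, ∑ g ∈ s, ∑ h ∈ s, (u g i - u h i)^2 
        = 2 * s.card * ∑ g ∈ s, (u g i)^2 - 2 * (∑ g ∈ s, u g i)^2 := by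
      intro i
      have : ∀ g h, (u g i - u h i)^2 = (u g i)^2 + (u h i)^2 - 2 * (u g i * u h i) := by
        intros; ring
      simp only [this, Finset.sum_sub_distrib, Finset.sum_add_distrib, Finset.sum_const, nsmul_eq_mul,
        ← Finset.mul_sum, ← Finset.sum_mul]
      ring
    have h3 : ∑ g ∈ s, ∑ h ∈ s, ∑ i, (u g i - u h i)^2 = ∑ i, ∑ g ∈ s, ∑ h ∈ s, (u g i - u h i)^2 := by
      rw [Finset.sum_comm (s := Finset.univ) (t := s)]
      refine Finset.sum_congr rfl fun g _ => ?_
      rw [Finset.sum_comm]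
    have h4 : ∑ g ∈ s, ∑ i, (u g i)^2 = ∑ i, ∑ g ∈ s, (u g i)^2 := Finset.sum_comm
    rw [h3, h4, Finset.mul_sum]
    refine Finset.sum_le_sum fun i _ => ?_
    rw [this]
    nlinarith [sq_nonneg (∑ g ∈ s, u g i)]
  have e2 : ∑ g ∈ s, ∑ i, (u g i)^2 < s.card * (3/2 : ℝ) := by
    rw [← nsmul_eq_mul]
    calc _ < ∑ g ∈ s, (3/2:ℝ) := Finset.sum_lt_sum_of_nonempty hs h1
      _ = _ := by simp
  have e3 : (s.card : ℝ) * ((s.card - 1) * 4) ≤ ∑ g ∈ s, ∑ h ∈ s, ∑ i, (u g i - u h i)^2 := by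
    rw [← nsmul_eq_mul]
    refine Finset.card_nsmul_le_sum _ _ _ fun g hg => ?_
    rw [← Finset.add_sum_erase _ _ hg]
    have : ((s.erase g).card : ℝ) * 4 ≤ ∑ h ∈ s.erase g, ∑ i, (u g i - u h i)^2 := by
      rw [← nsmul_eq_mul]
      refine Finset.card_nsmul_le_sum _ _ _ fun h hh => ?_
      exact h2 g hg h (Finset.mem_of_mem_erase hh) (Finset.ne_of_mem_erase hh).symm
    rw [Finset.card_erase_of_mem hg, Nat.cast_sub (by omega)] at this
    simpa using this
  by_contra hc
  have hc' : (4:ℝ) ≤ s.card := by exact_mod_cast (by omega : 4 ≤ s.card)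
  nlinarith

lemma aux_mult {E L : Type*} [MeasurableSpace E] {μ : Measure E} {F B : Set E} [AddGroup L] [Countable L]
    [AddAction L E] [MeasurableSpace L] [MeasurableVAdd L E] [VAddInvariantMeasure L E μ]
    (fund : IsAddFundamentalDomain L F μ) (hB : MeasurableSet B)
    (h : ∀ (x : E) (s : Finset L), (∀ g ∈ s, x ∈ g +ᵥ B) → s.card ≤ 3) : μ B ≤ 3 * μ F := by
  classical
  rw [fund.measure_eq_tsum]
  have hm : ∀ g : L, MeasurableSet (g +ᵥ B) := fun g => hB.const_vadd g
  calc ∑' g : L, μ ((g +ᵥ B) ∩ F) = ∑' g : L, ∫⁻ x in F, (g +ᵥ B).indicator 1 x ∂μ := by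
        refine tsum_congr fun g => ?_
        rw [lintegral_indicator_one (hm g), Measure.restrict_apply (hm g)]
    _ = ∫⁻ x in F, ∑' g : L, (g +ᵥ B).indicator 1 x ∂μ := by
        rw [lintegral_tsum]
        intro g
        exact (measurable_one.indicator (hm g)).aemeasurable
    _ ≤ ∫⁻ x in F, 3 ∂μ := by
        refine lintegral_mono fun x => ?_
        simp only
        rw [ENNReal.tsum_eq_iSup_sum]
        refine iSup_le fun s => ?_
        have := h x (s.filter fun g => x ∈ g +ᵥ B) (by simp)
        simp only [Set.indicator_apply, Pi.one_apply, Finset.sum_boole]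
        exact_mod_cast this
    _ = 3 * μ F := by simp


lemma aux_fac {n : ℕ} (G : Matrix (Fin n) (Fin n) ℝ) (hG : G.PosDef) :
    ∃ A : Matrix (Fin n) (Fin n) ℝ, G = A.transpose * A := by
  obtain ⟨B, hB⟩ := CStarAlgebra.nonneg_iff_eq_star_mul_self.mp hG.posSemidef.nonneg
  refine ⟨B, ?_⟩
  rw [← Matrix.conjTranspose_eq_transpose_of_trivial]; exact hB

lemma aux_vol {k : ℕ} (hk : 0 < k) : 
    volume {x : Fin (2*k) → ℝ | ∑ i, (x i)^2 < 3/2} = ENNReal.ofReal ((3/2)^k * (Real.pi ^ k / k.factorial)) := by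
  have : Nontrivial (EuclideanSpace ℝ (Fin (2*k))) := by
    apply Module.nontrivial_of_finrank_pos (R := ℝ)
    simp [hk]
  have h := InnerProductSpace.volume_ball_of_dim_even (E := EuclideanSpace ℝ (Fin (2*k))) (k := k) (by simp) 0 (√(3/2))
  rw [← (PiLp.volume_preserving_toLp (Fin (2*k))).measure_preimage
      measurableSet_ball.nullMeasurableSet] at h
  rw [← ENNReal.ofReal_pow (by positivity), ← ENNReal.ofReal_mul (by positivity)] at h
  simp only [finrank_euclideanSpace, Fintype.card_fin] at h
  rw [pow_mul, Real.sq_sqrt (by norm_num)] at h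
  rw [← h]
  congr 1
  ext x
  simp only [Set.mem_ofPred_eq, Set.mem_preimage, Metric.mem_ball, dist_zero_right, EuclideanSpace.norm_eq]
  rw [Real.sqrt_lt_sqrt_iff (by positivity)]
  simp

lemma blich {k : ℕ} (hk : 0 < k) (G : Matrix (Fin (2*k)) (Fin (2*k)) ℝ) (hG : G.PosDef)
    (hmin : ∀ z : Fin (2*k) → ℤ, z ≠ 0 → 4 ≤ (fun i => (z i : ℝ)) ⬝ᵥ G.mulVec (fun i => (z i : ℝ))) :
    (3/2)^k * (Real.pi ^ k / k.factorial) ≤ 3 * √ G.det := by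
  obtain ⟨A, hA⟩ := aux_fac G hG
  have hdet : G.det = A.det ^ 2 := by rw [hA, Matrix.det_mul, Matrix.det_transpose]; ring
  have hdet0 : A.det ≠ 0 := by
    intro h; have := hG.det_pos; rw [hdet, h] at this; simp at this
  have hq : ∀ v : Fin (2*k) → ℝ, v ⬝ᵥ G.mulVec v = ∑ i, (A.mulVec v i)^2 := by
    intro v
    rw [hA, ← Matrix.mulVec_mulVec, Matrix.dotProduct_mulVec, Matrix.vecMul_transpose]
    simp [dotProduct, sq]
  set b := Pi.basisFun ℝ (Fin (2*k)) with hb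
  have fund := ZSpan.isAddFundamentalDomain' b (volume : Measure (Fin (2*k) → ℝ))
  set B : Set (Fin (2*k) → ℝ) := (Matrix.toLin' A) ⁻¹' {x | ∑ i, (x i)^2 < 3/2} with hB
  have hBm : MeasurableSet B := by
    have h1 : MeasurableSet {x : Fin (2*k) → ℝ | ∑ i, (x i)^2 < 3/2} :=
      measurableSet_lt (by fun_prop) (by fun_prop)
    exact (LinearMap.continuous_of_finiteDimensional (Matrix.toLin' A)).measurable h1
  have : Countable (Submodule.span ℤ (Set.range b)).toAddSubgroup :=
    inferInstanceAs (Countable (Submodule.span ℤ (Set.range b)))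
  have key := aux_mult fund hBm (by
    classical
    intro x s hs
    refine aux_card s (fun g => A.mulVec (x - (g : Fin (2*k) → ℝ))) ?_ ?_
    · intro g hg
      have := hs g hg
      rw [Set.mem_vadd_set_iff_neg_vadd_mem] at this
      simp only [hB, Set.mem_preimage, Set.mem_ofPred_eq, Matrix.toLin'_apply] at this
      have e : -g +ᵥ x = x - (g : Fin (2*k) → ℝ) := by rw [sub_eq_neg_add]; rfl
      rw [e] at this
      exact this
    · intro g _ h _ hgh
      obtain ⟨z, hz⟩ : ∃ z : Fin (2*k) → ℤ, ((h - g : (Submodule.span ℤ (Set.range b)).toAddSubgroup) : Fin (2*k) → ℝ) = fun i => (z i : ℝ) := by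
        have : _ ∈ Submodule.span ℤ (Set.range b) := (h - g).2
        rw [b.mem_span_iff_repr_mem ℤ] at this
        choose z hz using this
        exact ⟨z, funext fun i => by simpa [hb] using (hz i).symm⟩
      have hz0 : z ≠ 0 := by
        rintro rfl
        apply hgh
        have : h - g = 0 := by
          apply Subtype.ext; rw [hz]; ext; simp
        exact (sub_eq_zero.1 this).symm
      have := hmin z hz0
      rw [hq, ← hz] at this
      convert this using 3 with i
      rw [← Pi.sub_apply, ← Matrix.mulVec_sub]
      have e : ((h - g : (Submodule.span ℤ (Set.range b)).toAddSubgroup) : Fin (2*k) → ℝ)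
          = x - (g : Fin (2*k) → ℝ) - (x - (h : Fin (2*k) → ℝ)) := by
        push_cast
        abel
      rw [e])
  rw [hB, Measure.addHaar_preimage_linearMap _ (by simpa using hdet0), aux_vol hk, hb, ZSpan.volume_fundamentalDomain, LinearMap.det_toLin'] at key
  have h1 : |(Matrix.of (Pi.basisFun ℝ (Fin (2*k)))).det| = 1 := by
    have : (Matrix.of (Pi.basisFun ℝ (Fin (2*k)))) = 1 := by
      ext i j; simp [Matrix.one_apply, Pi.single_apply, eq_comm]
    rw [this]; simp
  rw [h1, ← ENNReal.ofReal_mul (by positivity), ENNReal.ofReal_one, mul_one, 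
    show (3 : ENNReal) = ENNReal.ofReal 3 by simp, ENNReal.ofReal_le_ofReal_iff (by norm_num)] at key
  rw [hdet, Real.sqrt_sq_eq_abs]
  have h3 : 0 < |A.det| := abs_pos.2 hdet0
  rw [abs_inv, inv_mul_le_iff₀ h3] at key
  linarith

lemma cyc {k p : ℕ} (hp : p.Prime) (A : Matrix (Fin k) (Fin k) ℤ)
    (hA : ∑ i ∈ Finset.range p, A ^ i = 0) (hk : 0 < k) (hk2 : k < 2 * (p - 1)) :
    k = p - 1 ∧ (1 - A).det = p := by
  have : Fact p.Prime := ⟨hp⟩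
  have : Nonempty (Fin k) := ⟨⟨0, hk⟩⟩
  set Q := A.map (Int.castRingHom ℚ) with hQ
  have hQ0 : Polynomial.aeval Q (Polynomial.cyclotomic p ℚ) = 0 := by
    have h1 : Q = (Int.castRingHom ℚ).mapMatrix A := rfl
    have := congrArg (Int.castRingHom ℚ).mapMatrix hA
    rw [Polynomial.cyclotomic_prime]
    simp only [map_sum, map_pow, map_zero, Polynomial.aeval_X, ← h1] at this ⊢
    exact this
  have hirr := Polynomial.cyclotomic.irreducible_rat hp.pos
  have hmon := Polynomial.cyclotomic.monic p ℚ
  have hdeg : (Polynomial.cyclotomic p ℚ).natDegree = p - 1 := by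
    rw [Polynomial.natDegree_cyclotomic, Nat.totient_prime hp]
  have hmin : minpoly ℚ Q = Polynomial.cyclotomic p ℚ :=
    (minpoly.eq_of_irreducible_of_monic hirr hQ0 hmon).symm
  obtain ⟨r, hr⟩ : Polynomial.cyclotomic p ℚ ∣ Q.charpoly := hmin ▸ Matrix.minpoly_dvd_charpoly Q
  have hcm := Q.charpoly_monic
  have hrm : r.Monic := hmon.of_mul_monic_left (hr ▸ hcm)
  have hcd : Q.charpoly.natDegree = k := by simp [Matrix.charpoly_natDegree_eq_dim]
  have hkr : k = p - 1 + r.natDegree := by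
    rw [← hcd, hr, hmon.natDegree_mul hrm, hdeg]
  have hr1 : r = 1 := by
    by_contra hne
    have hnu : ¬ IsUnit r := fun hu => hne (hrm.eq_one_of_isUnit hu)
    obtain ⟨q, hq, hqr⟩ := WfDvdMonoid.exists_irreducible_factor hnu hrm.ne_zero
    have hqd : q.degree ≠ 0 := (Polynomial.degree_pos_of_irreducible hq).ne'
    let L := AlgebraicClosure ℚ
    obtain ⟨μ, hμ⟩ := IsAlgClosed.exists_aeval_eq_zero L q hqd
    have hμc : Polynomial.aeval μ Q.charpoly = 0 := by
      obtain ⟨c, hc⟩ := hqr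
      rw [hr, hc]; simp [hμ]
    let QL := Q.map (algebraMap ℚ L)
    have hroot : QL.charpoly.IsRoot μ := by
      rw [Matrix.charpoly_map, Polynomial.IsRoot, Polynomial.eval_map_algebraMap]; exact hμc
    have hspec := Matrix.mem_spectrum_of_isRoot_charpoly hroot
    have hQL0 : Polynomial.aeval QL (Polynomial.cyclotomic p L) = 0 := by
      have h1 : QL = (algebraMap ℚ L).mapMatrix Q := rfl
      have := congrArg (algebraMap ℚ L).mapMatrix hQ0
      rw [Polynomial.cyclotomic_prime] at this ⊢
      simp only [map_sum, map_pow, map_zero, Polynomial.aeval_X, ← h1] at this ⊢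
      exact this
    have h2 := spectrum.subset_polynomial_aeval QL (Polynomial.cyclotomic p L) ⟨μ, hspec, rfl⟩
    rw [hQL0, spectrum.zero_eq] at h2
    have h3 : Polynomial.aeval μ (Polynomial.cyclotomic p ℚ) = 0 := by
      rw [← Polynomial.eval_map_algebraMap, Polynomial.map_cyclotomic]; simpa using h2
    have h4 : q ∣ Polynomial.cyclotomic p ℚ := by
      rwa [hq.dvd_iff_aeval_eq_zero hμ] at h3
    have h5 : Polynomial.cyclotomic p ℚ ∣ r := (hq.dvd_symm hirr h4).trans hqr
    have h6 := Polynomial.natDegree_le_of_dvd h5 hrm.ne_zero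
    omega
  subst hr1
  simp at hkr
  refine ⟨hkr, ?_⟩
  have h1 : ((1 - A).det : ℚ) = p := by
    have h2 := Matrix.eval_charpoly Q 1
    rw [hr, mul_one, Polynomial.eval_one_cyclotomic_prime] at h2
    rw [h2]
    have := (Int.castRingHom ℚ).map_det (1 - A)
    simp only [eq_intCast] at this
    rw [this, map_sub, map_one, map_one]; rfl
  exact_mod_cast h1

lemma int_posDef {n : ℕ} (M : Matrix (Fin n) (Fin n) ℤ) (hs : M.IsSymm) (hd : M.det ≠ 0)
    (h : ∀ c : Fin n → ℤ, c ≠ 0 → 4 ≤ c ⬝ᵥ M.mulVec c) :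
    (M.map (Int.castRingHom ℝ)).PosDef := by
  have hdet : (M.map (Int.castRingHom ℝ)).det ≠ 0 := by
    have := (Int.castRingHom ℝ).map_det M
    rw [← RingHom.mapMatrix_apply, ← this]
    simpa using hd
  have hint : ∀ c : Fin n → ℤ, (fun i => (c i : ℝ)) ⬝ᵥ (M.map (Int.castRingHom ℝ)).mulVec (fun i => (c i : ℝ))
      = ((c ⬝ᵥ M.mulVec c : ℤ) : ℝ) := by
    intro c
    simp [dotProduct, Matrix.mulVec]
  have hrat : ∀ c : Fin n → ℚ, 0 ≤ (fun i => (c i : ℝ)) ⬝ᵥ (M.map (Int.castRingHom ℝ)).mulVec (fun i => (c i : ℝ)) := by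
    intro c
    obtain ⟨d, hd⟩ := IsLocalization.exist_integer_multiples_of_finite (nonZeroDivisors ℤ) c
    choose z hz using hd
    have hz' : (fun i => (z i : ℝ)) = ((d : ℤ) : ℝ) • (fun i => (c i : ℝ)) := by
      ext i
      have := hz i
      simp at this
      simp only [Pi.smul_apply, smul_eq_mul]
      exact_mod_cast this
    have h1 := hint z
    rw [hz', Matrix.mulVec_smul, smul_dotProduct, dotProduct_smul] at h1
    simp only [smul_eq_mul] at h1
    have h2 : (0:ℝ) ≤ ((z ⬝ᵥ M.mulVec z : ℤ) : ℝ) := by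
      by_cases hz0 : z = 0
      · simp [hz0]
      · have := h z hz0
        exact_mod_cast (by omega)
    have h3 : ((d : ℤ) : ℝ) ≠ 0 := by
      have := nonZeroDivisors.coe_ne_zero d
      exact_mod_cast this
    have h4 : 0 < ((d : ℤ) : ℝ)^2 := by positivity
    rw [← h1, ← mul_assoc, ← sq] at h2
    exact nonneg_of_mul_nonneg_right h2 h4
  have hpsd : (M.map (Int.castRingHom ℝ)).PosSemidef := by
    refine Matrix.PosSemidef.of_dotProduct_mulVec_nonneg ?_ ?_
    · ext i j
      have := hs.apply i j
      simp [this]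
    · intro x
      have hx : star x = x := by ext; simp
      rw [hx]
      have hdense : DenseRange (fun c : Fin n → ℚ => fun i => (c i : ℝ)) :=
        DenseRange.piMap (fun _ => Rat.denseRange_cast)
      refine hdense.induction_on (p := fun x => 0 ≤ x ⬝ᵥ (M.map (Int.castRingHom ℝ)).mulVec x) x ?_ hrat
      refine isClosed_le (by fun_prop) ?_
      simp only [dotProduct, Matrix.mulVec]
      fun_prop
  exact hpsd.posDef_iff_det_ne_zero.2 hdet

lemma index_range_eq {k : ℕ} (A : Matrix (Fin k) (Fin k) ℤ) (hA : A.det ≠ 0) :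
    (LinearMap.range (Matrix.toLin' A)).toAddSubgroup.index = A.det.natAbs := by
  have hinj : Function.Injective (Matrix.toLin' A) := by
    rw [← LinearMap.ker_eq_bot]
    rw [Matrix.ker_toLin'_eq_bot_iff]
    intro v hv
    exact Matrix.eq_zero_of_mulVec_eq_zero hA hv
  have := Submodule.natAbs_det_equiv (LinearMap.range (Matrix.toLin' A))
    (LinearEquiv.ofInjective (Matrix.toLin' A) hinj)
  have e : (LinearMap.range (Matrix.toLin' A)).subtype ∘ₗ AddMonoidHom.toIntLinearMap
     ((LinearEquiv.ofInjective (Matrix.toLin' A) hinj) : (Fin k → ℤ) →+ LinearMap.range (Matrix.toLin' A)) = Matrix.toLin' A := by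
    ext; rfl
  rw [e, LinearMap.det_toLin'] at this
  rw [this]; rfl

lemma fin_arith {n k p : ℕ} (hk : n = 2 * k) (M : Matrix (Fin n) (Fin n) ℤ) (hs : M.IsSymm)
    (hd : M.det ≠ 0) (h : ∀ c : Fin n → ℤ, c ≠ 0 → 4 ≤ c ⬝ᵥ M.mulVec c)
    (hle : M.det.natAbs ≤ p)
    (hkk : (k = 6 ∧ p = 13) ∨ (k = 4 ∧ p = 17) ∨ (k = 3 ∧ p = 19)) : False := by
  subst hk
  have h1 := blich (by omega) _ (int_posDef M hs hd h) (by
    intro z hz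
    have e : (fun i => (z i : ℝ)) ⬝ᵥ (M.map (Int.castRingHom ℝ)).mulVec (fun i => (z i : ℝ))
        = ((z ⬝ᵥ M.mulVec z : ℤ) : ℝ) := by
      simp [dotProduct, Matrix.mulVec]
    rw [e]
    exact_mod_cast h z hz)
  have h2 : (M.map (Int.castRingHom ℝ)).det ≤ p := by
    have e := (Int.castRingHom ℝ).map_det M
    rw [← RingHom.mapMatrix_apply, ← e]
    have : M.det ≤ p := by omega
    simpa using (by exact_mod_cast this : (M.det : ℝ) ≤ p)
  have h3 : (3:ℝ)^k ≤ Real.pi ^ k := pow_le_pow_left₀ (by norm_num) Real.pi_gt_three.le k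
  have h4 : (3/2:ℝ)^k * (3 ^ k / k.factorial) ≤ 3 * √(p : ℝ) := by
    calc _ ≤ (3/2)^k * (Real.pi ^ k / k.factorial) := by gcongr
      _ ≤ _ := h1
      _ ≤ _ := by gcongr
  have h6 : ((3/2:ℝ)^k * (3 ^ k / k.factorial)) ^ 2 ≤ 9 * p := by
    calc _ ≤ (3 * √(p : ℝ)) ^ 2 := by gcongr
      _ = 9 * p := by rw [mul_pow, Real.sq_sqrt (by positivity)]; norm_num
  rcases hkk with ⟨rfl, rfl⟩ | ⟨rfl, rfl⟩ | ⟨rfl, rfl⟩ <;>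
    norm_num [Nat.factorial] at h6

end Helpers

/-- an isometry of prime order `p ≥ 13` of the Leech lattice has
coinvariant lattice of rank at least 22. -/
theorem stmt14
    (Λ : Type*) [AddCommGroup Λ] [Module.Free ℤ Λ] [Module.Finite ℤ Λ]
    (bΛ : Λ →ₗ[ℤ] Λ →ₗ[ℤ] ℤ)
    (hsymm : ∀ x y : Λ, bΛ x y = bΛ y x)
    (heven : ∀ x : Λ, Even (bΛ x x))
    (hneg : ∀ x : Λ, x ≠ 0 → bΛ x x < 0)
    (hrank : finrank ℤ Λ = 24)
    (hunimodular : Function.Bijective bΛ)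
    (hnoroot : ∀ x : Λ, bΛ x x ≠ -2)
    (f : Λ ≃ₗ[ℤ] Λ)
    (hiso : ∀ x y : Λ, bΛ (f x) (f y) = bΛ x y)
    (p : ℕ) (hp : p.Prime) (hp13 : 13 ≤ p)
    (hord : orderOf f = p) :
    22 ≤ finrank ℤ (orthSub bΛ (fixSub f)) := by
  by_contra hlt
  push Not at hlt
  set T := fixSub f with hT
  set S := orthSub bΛ T with hS
  have memT : ∀ x, x ∈ T ↔ f x = x := by
    intro x; simp [hT, fixSub, sub_eq_zero]
  have memS : ∀ x, x ∈ S ↔ ∀ y ∈ T, bΛ x y = 0 := fun x => Iff.rfl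
  have hTS : ∀ x, x ∈ T → x ∈ S → x = 0 := by
    intro x hx hx'
    by_contra h
    have := hneg x h
    rw [(memS x).1 hx' x hx] at this
    exact lt_irrefl _ this
  have hfp : f ^ p = 1 := by rw [← hord]; exact pow_orderOf_eq_one f
  -- the map 1 - f
  have hth : ∀ x, x - f x ∈ S := by
    intro x
    rw [memS]
    intro y hy
    have h1 := hiso x y
    rw [(memT y).1 hy] at h1
    simp [h1]
  have hfS : ∀ x ∈ S, f x ∈ S := by
    intro x hx
    have := S.sub_mem hx (hth x)
    simpa using this
  -- basis of S and matrix of f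
  let bS := Module.finBasis ℤ S
  let g : S →ₗ[ℤ] S := f.toLinearMap.restrict hfS
  let A := LinearMap.toMatrix bS bS g
  have hgpow : ∀ (i : ℕ) (x : S), ((g ^ i) x : Λ) = (f ^ i) (x : Λ) := by
    intro i
    induction i with
    | zero => intro x; simp
    | succ i ih => 
      intro x
      rw [pow_succ', pow_succ']
      simp only [Module.End.mul_apply, LinearEquiv.mul_apply]
      rw [← ih]; rfl
  have hsumT : ∀ x : Λ, ∑ i ∈ Finset.range p, (f ^ i) x ∈ T := by
    intro x
    rw [memT, map_sum]
    have h1 : ∀ i, f ((f ^ i) x) = (f ^ (i+1)) x := by intro i; rw [pow_succ']; rfl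
    simp only [h1]
    have h2 := Finset.sum_range_succ (fun i => (f^i) x) p
    have h3 := Finset.sum_range_succ' (fun i => (f^i) x) p
    rw [h2, hfp] at h3
    simpa using h3.symm
  have hgsum : ∑ i ∈ Finset.range p, g ^ i = 0 := by
    ext x
    simp only [LinearMap.sum_apply, LinearMap.zero_apply, AddSubmonoidClass.coe_finsetSum, ZeroMemClass.coe_zero, hgpow]
    refine hTS _ (hsumT _) ?_
    simp only [← hgpow]
    exact S.sum_mem fun i _ => ((g^i) x).2
  have hA0 : ∑ i ∈ Finset.range p, A ^ i = 0 := by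
    have := congrArg (LinearMap.toMatrixAlgEquiv bS) hgsum
    simp only [map_sum, map_pow, map_zero] at this
    exact this
  have hSpos : 0 < finrank ℤ S := by
    by_contra h0
    have h0 : finrank ℤ S = 0 := by omega
    have hS0 : ∀ x ∈ S, x = 0 := by
      have := (Submodule.finrank_eq_zero (S := S)).1 h0
      intro x hx; rw [this] at hx; simpa using hx
    have : f = 1 := by
      ext x
      have := hS0 _ (hth x)
      exact (sub_eq_zero.1 this).symm
    rw [this, orderOf_one] at hord
    omega
  obtain ⟨hkS, hdetA⟩ := cyc hp A hA0 hSpos (by omega)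
  -- index computations
  have hidxS : (LinearMap.range (Matrix.toLin' (1 - A))).toAddSubgroup.index = p := by
    rw [index_range_eq _ (by rw [hdetA]; exact_mod_cast hp.ne_zero), hdetA]; simp
  let th : Λ →ₗ[ℤ] S := (LinearMap.id - f.toLinearMap).codRestrict S hth
  let th' : Λ →ₗ[ℤ] (Fin (finrank ℤ S) → ℤ) := bS.equivFun.toLinearMap ∘ₗ th
  have hth' : ∀ s : S, th' s = Matrix.toLin' (1 - A) (bS.equivFun s) := by
    intro s
    have h1 : Matrix.toLin' A (bS.equivFun s) = bS.equivFun (g s) := by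
      have := LinearMap.toMatrix_mulVec_repr bS bS g s
      rw [Matrix.toLin'_apply]
      exact this
    rw [map_sub, LinearMap.sub_apply, h1, Matrix.toLin'_one, LinearMap.id_apply, ← map_sub]
    rfl
  have hker : ∀ x, th' x = 0 ↔ x ∈ T := by
    intro x
    simp only [th', LinearMap.comp_apply, LinearEquiv.coe_coe, LinearEquiv.map_eq_zero_iff]
    rw [memT, ← Subtype.coe_inj]
    simp only [th, LinearMap.codRestrict_apply, LinearMap.sub_apply, LinearMap.id_apply,
      LinearEquiv.coe_coe, ZeroMemClass.coe_zero]
    rw [sub_eq_zero, eq_comm]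
  have hcomap1 : ((LinearMap.range (Matrix.toLin' (1 - A))).comap th') = T ⊔ S := by
    ext x
    rw [Submodule.mem_comap, LinearMap.mem_range, Submodule.mem_sup]
    constructor
    · rintro ⟨y, hy⟩
      obtain ⟨s, rfl⟩ := bS.equivFun.surjective y
      rw [← hth'] at hy
      refine ⟨x - s, ?_, s, s.2, by simp⟩
      rw [← hker, map_sub, hy, sub_self]
    · rintro ⟨t, ht, s, hs, rfl⟩
      refine ⟨bS.equivFun ⟨s, hs⟩, ?_⟩
      rw [← hth', map_add, (hker t).2 ht, zero_add]
  -- the other side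
  let bT := Module.finBasis ℤ T
  set n := finrank ℤ T with hn
  let pr : Λ →ₗ[ℤ] (Fin n → ℤ) := LinearMap.pi fun i => bΛ.flip (bT i)
  have hpr : ∀ x i, pr x i = bΛ x (bT i) := fun x i => rfl
  have hprker : ∀ x, pr x = 0 ↔ x ∈ S := by
    intro x
    rw [memS]
    constructor
    · intro h y hy
      have : (bΛ x) ∘ₗ T.subtype = 0 := bT.ext fun i => congrFun h i
      exact LinearMap.congr_fun this ⟨y, hy⟩
    · intro h
      ext i
      exact h _ (bT i).2
  have hprsurj : Function.Surjective pr := by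
    -- retraction onto T
    have hproj : ∃ s : LinearMap.range th →ₗ[ℤ] Λ, th.rangeRestrict ∘ₗ s = LinearMap.id :=
      Module.projective_lifting_property _ _ th.surjective_rangeRestrict
    obtain ⟨s, hs⟩ := hproj
    have hret : ∀ x, x - s (th.rangeRestrict x) ∈ T := by
      intro x
      have h1 : th.rangeRestrict (x - s (th.rangeRestrict x)) = 0 := by
        rw [map_sub, sub_eq_zero]
        exact (LinearMap.congr_fun hs _).symm
      have h2 : th (x - s (th.rangeRestrict x)) = 0 := congrArg Subtype.val h1
      rw [← hker]
      simp only [th', LinearMap.comp_apply, h2, map_zero]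
    let r : Λ →ₗ[ℤ] T := (LinearMap.id - s ∘ₗ th.rangeRestrict).codRestrict T hret
    have hr : ∀ t : T, r t = t := by
      intro t
      apply Subtype.ext
      have h1 : th.rangeRestrict (t : Λ) = 0 := by
        apply Subtype.ext
        have := (hker t).2 t.2
        simpa [th'] using this
      change (t : Λ) - s (th.rangeRestrict t) = t
      rw [h1]; simp
    intro c
    obtain ⟨x, hx⟩ := hunimodular.2 ((bT.constr ℤ c) ∘ₗ r)
    refine ⟨x, ?_⟩
    ext i
    rw [hpr, hx, LinearMap.comp_apply, hr, Basis.constr_basis]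
  let M : Matrix (Fin n) (Fin n) ℤ := Matrix.of fun i j => - bΛ (bT i) (bT j)
  have hMt : ∀ c : Fin n → ℤ, Matrix.toLin' M c = - pr (bT.equivFun.symm c : T) := by
    intro c
    ext i
    rw [Pi.neg_apply, hpr, hsymm, Matrix.toLin'_apply, Basis.equivFun_symm_apply]
    simp [M, Matrix.mulVec, dotProduct, mul_comm]
  have hMq : ∀ c : Fin n → ℤ, c ⬝ᵥ M.mulVec c = - bΛ (bT.equivFun.symm c : T) (bT.equivFun.symm c : T) := by
    intro c
    rw [← Matrix.toLin'_apply, hMt]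
    set v := bT.equivFun.symm c with hv
    have : (v : Λ) = ∑ i, c i • (bT i : Λ) := by
      rw [hv, Basis.equivFun_symm_apply]; simp
    conv_rhs => rw [hsymm]; arg 1; arg 2; rw [this]
    simp [dotProduct, hpr]
  have hcne : ∀ c : Fin n → ℤ, c ≠ 0 → ((bT.equivFun.symm c : T) : Λ) ≠ 0 := by
    intro c hc h
    apply hc
    have : bT.equivFun.symm c = 0 := Subtype.ext h
    exact (LinearEquiv.map_eq_zero_iff _).1 this
  have hMmin : ∀ c : Fin n → ℤ, c ≠ 0 → 4 ≤ c ⬝ᵥ M.mulVec c := by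
    intro c hc
    rw [hMq]
    have h1 := hneg _ (hcne c hc)
    have h2 := hnoroot (bT.equivFun.symm c : T)
    obtain ⟨m, hm⟩ := heven (bT.equivFun.symm c : T)
    omega
  have hMdet0 : M.det ≠ 0 := by
    intro h
    obtain ⟨v, hv, hv0⟩ := Matrix.exists_mulVec_eq_zero_iff.2 h
    have := hMmin v hv
    rw [hv0] at this
    simp at this
  have hcomap2 : ((LinearMap.range (Matrix.toLin' M)).comap pr) = T ⊔ S := by
    ext x
    rw [Submodule.mem_comap, LinearMap.mem_range, Submodule.mem_sup]
    constructor
    · rintro ⟨y, hy⟩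
      rw [hMt] at hy
      refine ⟨-(bT.equivFun.symm y : T), T.neg_mem (Subtype.mem _), x + (bT.equivFun.symm y : T), ?_, by simp⟩
      rw [← hprker, map_add, ← hy]; simp
    · rintro ⟨t, ht, s, hs, rfl⟩
      refine ⟨-bT.equivFun ⟨t, ht⟩, ?_⟩
      rw [map_neg, hMt, map_add, (hprker s).2 hs]
      simp
  have hidxM : M.det.natAbs ∣ p := by
    rw [← index_range_eq M hMdet0, ← hidxS]
    rw [← AddSubgroup.index_comap_of_surjective _ (f := pr.toAddMonoidHom) hprsurj]
    have e : (LinearMap.range (Matrix.toLin' M)).toAddSubgroup.comap pr.toAddMonoidHom = 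
        (LinearMap.range (Matrix.toLin' (1-A))).toAddSubgroup.comap th'.toAddMonoidHom := by
      ext x
      have := hcomap2.trans hcomap1.symm
      exact SetLike.ext_iff.1 this x
    rw [e, AddSubgroup.index_comap]
    exact AddSubgroup.relIndex_dvd_index_of_normal _ _
  have hrankT : n + finrank ℤ S = 24 := by
    have h1 := Submodule.finrank_quotient_add_finrank (LinearMap.ker pr)
    rw [hrank, (pr.quotKerEquivOfSurjective hprsurj).finrank_eq] at h1
    have h2 : LinearMap.ker pr = S := by ext x; exact hprker x
    rw [h2] at h1
    simpa using h1
  obtain ⟨k, hk, hkk⟩ : ∃ k, n = 2 * k ∧ ((k = 6 ∧ p = 13) ∨ (k = 4 ∧ p = 17) ∨ (k = 3 ∧ p = 19)) := by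
    have : p ≤ 22 := by omega
    interval_cases p <;> first | (exfalso; revert hp; norm_num; done) | exact ⟨n/2, by omega, by omega⟩
  have hMsymm : M.IsSymm := by
    ext i j
    simp [M, hsymm]
  have hMle : M.det.natAbs ≤ p := Nat.le_of_dvd hp.pos hidxM
  exact fin_arith hk M hMsymm hMdet0 hMmin hMle hkk
end
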